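/- arXiv:0907.0273 — 2 statements merged into one kernel-verified Lean document; each statement's English description precedes it below -/
import Mathlib

section
/- Fix n ≥ 1 and equip the space C(ℝ, Matrix (Fin n) (Fin n) ℝ) of continuous functions with the compact-open topology. Let 𝒮 be the set of pairs (A, f) with A : Matrix (Fin n) (Fin n) ℝ and f ∈ C(ℝ, Matrix (Fin n) (Fin n) ℝ) such that (f t).IsSymm and (f t).PosDef for every t, f (t+1) = A * (f t) * Aᵀ for every t, and (f t − f s).PosDef whenever s < t. Then every (A, f) ∈ 𝒮 has det A ≠ 0, the subsets 𝒮⁺ = {(A,f) ∈ 𝒮 | det A > 0} and 𝒮⁻ = {(A,f) ∈ 𝒮 | det A < 0} are both nonempty, and each of 𝒮⁺ and 𝒮⁻ is path-connected. (Hence the space of pairs consisting of a holonomy matrix and an equivariant positive path of positive-definite symmetric matrices has exactly two connected components, distinguished by the sign of the determinant of the holonomy.) -/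
open Matrix

/-- The predicate defining the space `𝒮` of pairs `(A, f)` of a holonomy matrix `A` and a
continuous path `f` of positive definite symmetric matrices, equivariant under `t ↦ t+1`
via conjugation by `A`, and strictly increasing for the Loewner order. -/
def GoodPair (n : ℕ)
    (p : Matrix (Fin n) (Fin n) ℝ × C(ℝ, Matrix (Fin n) (Fin n) ℝ)) : Prop :=
  (∀ t, (p.2 t).IsSymm) ∧ (∀ t, (p.2 t).PosDef) ∧
  (∀ t, p.2 (t + 1) = p.1 * p.2 t * p.1ᵀ) ∧
  (∀ s t : ℝ, s < t → (p.2 t - p.2 s).PosDef)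

open Set

namespace Matrix

theorem PosDef.mul_mul_transpose {m : Type*} [Fintype m] [DecidableEq m] {P A : Matrix m m ℝ} (hP : P.PosDef) (hA : A.det ≠ 0) :
    (A * P * Aᵀ).PosDef := by
  have := hP.mul_mul_conjTranspose_same (B := A) (vecMul_injective_of_isUnit
    ((isUnit_iff_isUnit_det A).2 hA.isUnit))
  rwa [conjTranspose_eq_transpose_of_trivial] at this

theorem convex_setOf_posDef {m : Type*} : Convex ℝ {P : Matrix m m ℝ | P.PosDef} := by
  intro P hP Q hQ a b ha hb hab
  rcases ha.eq_or_lt with rfl | ha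
  · obtain rfl : b = 1 := by linarith
    simpa using hQ
  · exact (PosDef.smul hP ha).add_posSemidef (PosSemidef.smul hQ.posSemidef hb)

/-- Over a compact parameter space, a continuous family of positive definite matrices has a
multiple dominating any given continuous family of symmetric matrices. -/
theorem exists_forall_smul_sub_posDef {m : Type*} [Fintype m] {T : Type*} [TopologicalSpace T] [CompactSpace T]
    {M P : T → Matrix m m ℝ} (hM : Continuous M) (hP : Continuous P)
    (hMpos : ∀ s, (M s).PosDef) (hPsymm : ∀ s, (P s).IsHermitian) :
    ∃ c : ℝ, 1 ≤ c ∧ ∀ s, (c • M s - P s).PosDef := by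
  have hpos : ∀ s (x : m → ℝ), x ≠ 0 → 0 < x ⬝ᵥ M s *ᵥ x := fun s x hx => by
    simpa using (hMpos s).dotProduct_mulVec_pos hx
  have hK : IsCompact ((univ : Set T) ×ˢ Metric.sphere (0 : m → ℝ) 1) :=
    isCompact_univ.prod (isCompact_sphere _ _)
  obtain ⟨C, hC⟩ := hK.exists_bound_of_continuousOn
    (f := fun q : T × (m → ℝ) => (q.2 ⬝ᵥ P q.1 *ᵥ q.2) / (q.2 ⬝ᵥ M q.1 *ᵥ q.2)) <| by
      refine ContinuousOn.div (by fun_prop) (by fun_prop) fun q hq => (hpos _ _ ?_).ne'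
      exact ne_zero_of_mem_unit_sphere ⟨q.2, hq.2⟩
  refine ⟨max 1 (C + 1), le_max_left _ _, fun s => .of_dotProduct_mulVec_pos ?_ fun x hx => ?_⟩
  · exact ((hMpos s).isHermitian.smul (.all _)).sub (hPsymm s)
  · have hx0 : 0 < ‖x‖ := norm_pos_iff.2 hx
    set u := ‖x‖⁻¹ • x with hu
    have hxu : x = ‖x‖ • u := by rw [hu, smul_smul, mul_inv_cancel₀ hx0.ne', one_smul]
    have hun : u ∈ Metric.sphere (0 : m → ℝ) 1 := by
      simp [hu, norm_smul, hx0.ne']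
    have hu0 : u ≠ 0 := ne_zero_of_mem_unit_sphere ⟨u, hun⟩
    have h1 := (le_abs_self _).trans (hC (s, u) ⟨mem_univ _, hun⟩)
    rw [div_le_iff₀ (hpos s u hu0)] at h1
    have h2 := hpos s u hu0
    have h3 : C + 1 ≤ max 1 (C + 1) := le_max_right _ _
    have h4 : 0 < max 1 (C + 1) * (u ⬝ᵥ M s *ᵥ u) - u ⬝ᵥ P s *ᵥ u := by
      dsimp only at h1
      nlinarith
    rw [hxu]
    simp only [star_trivial, sub_mulVec, smul_mulVec, mulVec_smul, dotProduct_sub,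
      dotProduct_smul, smul_dotProduct, smul_eq_mul]
    have := mul_pos (mul_pos hx0 hx0) h4
    linarith

section GeneralLinear

variable {m : Type*} [Fintype m] [DecidableEq m]

/-- The reflection in the `i`-th coordinate hyperplane. -/
def coordReflection (i : m) : Matrix m m ℝ := diagonal (Pi.mulSingle i (-1))

theorem det_diagonal_mulSingle (i : m) (x : ℝ) : (diagonal (Pi.mulSingle i x)).det = x := by
  rw [det_diagonal, Fintype.prod_pi_mulSingle']

theorem coordReflection_mul_self (i : m) : coordReflection i * coordReflection i = 1 := by
  rw [coordReflection, diagonal_mul_diagonal', ← diagonal_one]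
  congr 1
  funext j
  rw [← Pi.mul_apply, ← Pi.mulSingle_mul]
  simp

theorem joinedIn_diagonal_mulSingle (i : m) {x y : ℝ} {U : Set ℝ} (h : segment ℝ x y ⊆ U) :
    JoinedIn {A : Matrix m m ℝ | A.det ∈ U} (diagonal (Pi.mulSingle i x))
      (diagonal (Pi.mulSingle i y)) := by
  have hxy : JoinedIn (segment ℝ x y) x y :=
    (convex_segment x y).isPathConnected ⟨x, left_mem_segment ℝ x y⟩ |>.joinedIn _
      (left_mem_segment ℝ x y) _ (right_mem_segment ℝ x y)
  refine (hxy.map (f := fun x : ℝ => (diagonal (Pi.mulSingle i x) : Matrix m m ℝ)) ?_).mono ?_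
  · exact (continuous_mulSingle i).matrix_diagonal
  · rintro _ ⟨z, hz, rfl⟩
    simpa only [mem_ofPred_eq, det_diagonal_mulSingle] using h hz

theorem det_one_sub_householder (v : m → ℝ) (hv : v ≠ 0) :
    (1 - (2 / (v ⬝ᵥ v)) • vecMulVec v v).det = -1 := by
  have hvv : v ⬝ᵥ v ≠ 0 := by simpa using hv
  have : (1 - (2 / (v ⬝ᵥ v)) • vecMulVec v v) =
      1 + replicateCol Unit (-(2 / (v ⬝ᵥ v)) • v) * replicateRow Unit v := by
    rw [← vecMulVec_eq, smul_vecMulVec, neg_smul, sub_eq_add_neg]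
  rw [this, det_one_add_replicateCol_mul_replicateRow, dotProduct_smul, smul_eq_mul]
  field_simp
  norm_num

theorem coordReflection_eq_householder (i : m) :
    coordReflection i =
      1 - (2 / (Pi.single i (1 : ℝ) ⬝ᵥ Pi.single i 1)) • vecMulVec (Pi.single i 1)
        (Pi.single i 1) := by
  ext a b
  by_cases hab : a = b
  · subst hab
    by_cases hai : a = i
    · subst hai
      simp [coordReflection, vecMulVec_apply]
      norm_num
    · simp [coordReflection, vecMulVec_apply, hai]
  · by_cases hai : a = i
    · have : b ≠ i := fun h => hab (hai.trans h.symm)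
      simp [coordReflection, vecMulVec_apply, hab, this]
    · simp [coordReflection, vecMulVec_apply, hab, hai]

theorem joinedIn_coordReflection (i j : m) :
    JoinedIn {A : Matrix m m ℝ | A.det < 0} (coordReflection i) (coordReflection j) := by
  rcases eq_or_ne i j with rfl | hij
  · exact .refl (by simp [coordReflection])
  set v : ℝ → m → ℝ := fun t => (1 - t) • Pi.single i 1 + t • Pi.single j 1 with hv
  have hv0 : ∀ t, v t ≠ 0 := fun t h => by
    have h1 := congrFun h i
    have h2 := congrFun h j
    simp [hv, hij, hij.symm] at h1 h2
    linarith
  refine JoinedIn.ofLine (f := fun t => 1 - (2 / (v t ⬝ᵥ v t)) • vecMulVec (v t) (v t)) ?_ ?_ ?_ ?_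
  · refine Continuous.continuousOn ?_
    have : Continuous v := by fun_prop
    refine continuous_const.sub (Continuous.smul (continuous_const.div
      (Continuous.dotProduct this this) ?_) (this.matrix_vecMulVec this))
    exact fun t => by simpa using hv0 t
  · simp [hv, coordReflection_eq_householder]
  · simp [hv, coordReflection_eq_householder]
  · rintro _ ⟨t, -, rfl⟩
    simp only [mem_ofPred_eq, det_one_sub_householder _ (hv0 t)]
    norm_num

theorem joinedIn_transvection (t : TransvectionStruct m ℝ) :
    JoinedIn {A : Matrix m m ℝ | 0 < A.det} t.toMatrix 1 := by
  refine JoinedIn.symm (JoinedIn.ofLine (f := fun s : ℝ => transvection t.i t.j (s * t.c))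
    ?_ ?_ ?_ ?_)
  · refine Continuous.continuousOn ?_
    have : Continuous fun s : ℝ => (1 + s • single t.i t.j t.c : Matrix m m ℝ) := by fun_prop
    simpa only [transvection, smul_single, smul_eq_mul] using this
  · simp
  · simp [TransvectionStruct.toMatrix]
  · rintro _ ⟨s, -, rfl⟩
    simp [det_transvection_of_ne _ _ t.hij]

/-- Each invertible real matrix is joined, within the invertible matrices with the same sign of
the determinant, to the identity or to a fixed coordinate reflection. -/
theorem joinedIn_one_or_joinedIn_coordReflection (i : m) {A : Matrix m m ℝ} (hA : A.det ≠ 0) :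
    JoinedIn {A : Matrix m m ℝ | 0 < A.det} A 1 ∨
      JoinedIn {A : Matrix m m ℝ | A.det < 0} A (coordReflection i) := by
  have key : ∀ A B : Matrix m m ℝ,
      (JoinedIn {A : Matrix m m ℝ | 0 < A.det} A 1 ∨
        JoinedIn {A : Matrix m m ℝ | A.det < 0} A (coordReflection i)) →
      (JoinedIn {A : Matrix m m ℝ | 0 < A.det} B 1 ∨
        JoinedIn {A : Matrix m m ℝ | A.det < 0} B (coordReflection i)) →
      (JoinedIn {A : Matrix m m ℝ | 0 < A.det} (A * B) 1 ∨
        JoinedIn {A : Matrix m m ℝ | A.det < 0} (A * B) (coordReflection i)) := by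
    rintro A B (hA | hA) (hB | hB)
    · left
      simpa using (hA.mul hB).mono <| mul_subset_iff.2 fun x hx y hy => by
        simpa only [mem_ofPred_eq, det_mul] using mul_pos hx hy
    · right
      simpa using (hA.mul hB).mono <| mul_subset_iff.2 fun x hx y hy => by
        simpa only [mem_ofPred_eq, det_mul] using mul_neg_of_pos_of_neg hx hy
    · right
      simpa using (hA.mul hB).mono <| mul_subset_iff.2 fun x hx y hy => by
        simpa only [mem_ofPred_eq, det_mul] using mul_neg_of_neg_of_pos hx hy
    · left
      rw [← coordReflection_mul_self i]
      exact (hA.mul hB).mono <| mul_subset_iff.2 fun x hx y hy => by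
        simpa only [mem_ofPred_eq, det_mul] using mul_pos_of_neg_of_neg hx hy
  refine diagonal_transvection_induction_of_det_ne_zero _ A hA (fun d hd => ?_)
    (fun t => .inl (joinedIn_transvection t)) fun A B _ _ => key A B
  · rw [← Finset.univ_prod_mulSingle d]
    refine Finset.prod_induction _ (fun d : m → ℝ =>
      JoinedIn {A : Matrix m m ℝ | 0 < A.det} (diagonal d) 1 ∨
        JoinedIn {A : Matrix m m ℝ | A.det < 0} (diagonal d) (coordReflection i))
      (fun a b ha hb => ?_) ?_ fun j _ => ?_
    · have := key _ _ ha hb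
      rwa [diagonal_mul_diagonal'] at this
    · exact .inl (by rw [Pi.one_def, diagonal_one]; exact .refl (by simp))
    · have hdj : d j ≠ 0 := by
        rw [det_diagonal] at hd
        exact fun h => hd (Finset.prod_eq_zero (Finset.mem_univ j) h)
      rcases hdj.lt_or_gt with h | h
      · exact .inr ((joinedIn_diagonal_mulSingle j (U := Iio 0)
          ((convex_Iio 0).segment_subset h (by simp))).trans (joinedIn_coordReflection j i))
      · left
        have := joinedIn_diagonal_mulSingle j (U := Ioi 0)
          ((convex_Ioi 0).segment_subset h (mem_Ioi.2 one_pos))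
        rwa [Pi.mulSingle_one, Pi.one_def, diagonal_one] at this

theorem isPathConnected_setOf_det_pos [Nonempty m] :
    IsPathConnected {A : Matrix m m ℝ | 0 < A.det} := by
  refine ⟨1, by simp, fun {A} hA => ?_⟩
  obtain ⟨i⟩ := ‹Nonempty m›
  rcases joinedIn_one_or_joinedIn_coordReflection i (ne_of_gt hA) with h | h
  · exact h.symm
  · exact (lt_asymm (α := ℝ) hA h.source_mem).elim

theorem isPathConnected_setOf_det_neg [Nonempty m] :
    IsPathConnected {A : Matrix m m ℝ | A.det < 0} := by
  obtain ⟨i⟩ := ‹Nonempty m›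
  refine ⟨coordReflection i, by simp [coordReflection], fun {A} hA => ?_⟩
  rcases joinedIn_one_or_joinedIn_coordReflection i (ne_of_lt hA) with h | h
  · exact (lt_asymm (α := ℝ) hA h.source_mem).elim
  · exact h.symm

end GeneralLinear

section EquivariantInterpolation

variable {m : Type*} [Fintype m] [DecidableEq m]

/-- The `A`-equivariant path which interpolates linearly between `P` and `A * P * Aᵀ` on
the unit interval. -/
noncomputable def equivariantInterpolation (A P : Matrix m m ℝ) (t : ℝ) : Matrix m m ℝ :=
  A ^ ⌊t⌋ * (P + Int.fract t • (A * P * Aᵀ - P)) * (A ^ ⌊t⌋)ᵀ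

theorem equivariantInterpolation_add_one {A : Matrix m m ℝ} (hA : A.det ≠ 0) (P : Matrix m m ℝ)
    (t : ℝ) : equivariantInterpolation A P (t + 1) =
      A * equivariantInterpolation A P t * Aᵀ := by
  simp only [equivariantInterpolation, Int.floor_add_one, Int.fract_add_one, add_comm _ (1 : ℤ),
    zpow_one_add hA.isUnit, transpose_mul, Matrix.mul_assoc]

theorem equivariantInterpolation_of_mem_Icc {A : Matrix m m ℝ} (hA : A.det ≠ 0)
    (P : Matrix m m ℝ) (k : ℤ) {t : ℝ} (ht : t ∈ Icc (k : ℝ) (k + 1)) :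
    equivariantInterpolation A P t =
      A ^ k * (P + (t - k) • (A * P * Aᵀ - P)) * (A ^ k)ᵀ := by
  rcases ht.2.eq_or_lt with rfl | h
  · rw [equivariantInterpolation_add_one hA]
    simp only [equivariantInterpolation, Int.floor_intCast, Int.fract_intCast, zero_smul, add_zero,
      add_sub_cancel_left, one_smul, add_sub_cancel]
    have : A * A ^ k = A ^ k * A := by rw [← zpow_one_add hA.isUnit, add_comm,
      zpow_add_one hA.isUnit]
    calc A * (A ^ k * P * (A ^ k)ᵀ) * Aᵀ = (A * A ^ k) * P * (A * A ^ k)ᵀ := by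
          simp only [transpose_mul, Matrix.mul_assoc]
      _ = _ := by rw [this]; simp only [transpose_mul, Matrix.mul_assoc]
  · have : ⌊t⌋ = k := Int.floor_eq_iff.2 ⟨ht.1, h⟩
    rw [equivariantInterpolation, Int.fract, this]

theorem continuous_zpow_of_det_ne_zero {T : Type*} [TopologicalSpace T] {A : T → Matrix m m ℝ}
    (hA : Continuous A) (hdet : ∀ s, (A s).det ≠ 0) (k : ℤ) : Continuous fun s => A s ^ k := by
  have hinv : Continuous fun s => (A s)⁻¹ := by
    simp only [inv_def, Ring.inverse_eq_inv']
    exact (hA.matrix_det.inv₀ hdet).smul hA.matrix_adjugate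
  cases k with
  | ofNat k => simp only [Int.ofNat_eq_natCast, zpow_natCast]; fun_prop
  | negSucc k => simp only [zpow_negSucc, ← inv_pow']; fun_prop

theorem continuous_equivariantInterpolation {T : Type*} [TopologicalSpace T]
    {A P : T → Matrix m m ℝ} (hA : Continuous A) (hP : Continuous P)
    (hdet : ∀ s, (A s).det ≠ 0) :
    Continuous fun q : T × ℝ => equivariantInterpolation (A q.1) (P q.1) q.2 := by
  have hfin : LocallyFinite fun k : ℤ => Icc (k : ℝ) (k + 1) :=
    locallyFinite_Icc_of_tendsto tendsto_intCast_atTop_atTop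
      (Filter.tendsto_atBot_add_const_right _ _ (tendsto_intCast_atBot_iff.2 Filter.tendsto_id))
  refine (hfin.preimage_continuous continuous_snd (Y := T × ℝ)).continuous ?_
    (fun k => isClosed_Icc.preimage continuous_snd) fun k => ?_
  · rw [← preimage_iUnion, iUnion_Icc_intCast, preimage_univ]
  · have hk := (continuous_zpow_of_det_ne_zero hA hdet k).comp (continuous_fst (Y := ℝ))
    have hA' := hA.comp (continuous_fst (Y := ℝ))
    have hP' := hP.comp (continuous_fst (Y := ℝ))
    refine ContinuousOn.congr (f := fun q : T × ℝ => A q.1 ^ k *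
      (P q.1 + (q.2 - k) • (A q.1 * P q.1 * (A q.1)ᵀ - P q.1)) * (A q.1 ^ k)ᵀ)
      (Continuous.continuousOn ?_)
      fun q hq => equivariantInterpolation_of_mem_Icc (hdet _) _ k hq
    dsimp only [Function.comp_def] at hk hA' hP'
    fun_prop

theorem equivariantInterpolation_posDef {A P : Matrix m m ℝ} (hA : A.det ≠ 0) (hP : P.PosDef)
    (hAP : (A * P * Aᵀ - P).PosDef) (t : ℝ) : (equivariantInterpolation A P t).PosDef :=
  (hP.add_posSemidef (hAP.posSemidef.smul (Int.fract_nonneg t))).mul_mul_transpose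
    (hA.isUnit.det_zpow _).ne_zero

/-- A transitive relation which holds between any `s < t` in a common interval `[k, k + 1]`
with `k` an integer holds between any `s < t`. -/
theorem rel_of_lt_of_forall_Icc_int {r : ℝ → ℝ → Prop} (htrans : ∀ a b c, r a b → r b c → r a c)
    (h : ∀ (k : ℤ) (s t : ℝ), k ≤ s → s < t → t ≤ k + 1 → r s t) {s t : ℝ} (hst : s < t) :
    r s t := by
  have key : ∀ k : ℕ, ∀ t, s < t → t ≤ ⌊s⌋ + 1 + k → r s t := by
    intro k
    induction k with
    | zero => exact fun t hst ht => h ⌊s⌋ s t (Int.floor_le s) hst (by simpa using ht)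
    | succ k ih =>
      intro t hst ht
      rcases le_or_gt t (⌊s⌋ + 1 + k) with h' | h'
      · exact ih t hst h'
      · have hs := Int.lt_floor_add_one s
        have hk : (0 : ℝ) ≤ k := k.cast_nonneg
        refine htrans _ _ _ (ih (⌊s⌋ + 1 + k) (by linarith) le_rfl)
          (h (⌊s⌋ + 1 + k) _ _ (by push_cast; exact le_rfl) h' ?_)
        push_cast at ht ⊢
        linarith
  obtain ⟨k, hk⟩ := exists_nat_ge (t - ⌊s⌋ - 1)
  exact key k t hst (by linarith)

theorem equivariantInterpolation_sub_posDef {A P : Matrix m m ℝ} (hA : A.det ≠ 0)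
    (hAP : (A * P * Aᵀ - P).PosDef) {s t : ℝ} (hst : s < t) :
    (equivariantInterpolation A P t - equivariantInterpolation A P s).PosDef := by
  refine rel_of_lt_of_forall_Icc_int (r := fun s t =>
    (equivariantInterpolation A P t - equivariantInterpolation A P s).PosDef)
    (fun a b c hab hbc => by simpa using hbc.add hab) (fun k s t hs hst ht => ?_) hst
  rw [equivariantInterpolation_of_mem_Icc hA P k ⟨hs, hst.le.trans ht⟩,
    equivariantInterpolation_of_mem_Icc hA P k ⟨hs.trans hst.le, ht⟩, ← Matrix.sub_mul,
    ← Matrix.mul_sub, add_sub_add_left_eq_sub, ← sub_smul, sub_sub_sub_cancel_right]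
  exact (hAP.smul (sub_pos.2 hst)).mul_mul_transpose (hA.isUnit.det_zpow _).ne_zero

end EquivariantInterpolation

/-- Pairs `(A, P)` with `A ∈ S` and `P` positive definite, such that `A * P * Aᵀ` dominates `P`
strictly in the Loewner order. -/
def expandingPairs {m : Type*} [Fintype m] (S : Set (Matrix m m ℝ)) :
    Set (Matrix m m ℝ × Matrix m m ℝ) :=
  {q | q.1 ∈ S ∧ q.2.PosDef ∧ (q.1 * q.2 * q.1ᵀ - q.2).PosDef}

section ExpandingPairs

variable {m : Type*} [Fintype m] {S : Set (Matrix m m ℝ)}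

theorem smul_mul_mul_smul_transpose (c : ℝ) (A P : Matrix m m ℝ) :
    (c • A) * P * (c • A)ᵀ = (c * c) • (A * P * Aᵀ) := by
  simp [smul_smul]

variable [DecidableEq m]

theorem smul_mem_expandingPairs (hsmul : ∀ A ∈ S, ∀ c : ℝ, 0 < c → c • A ∈ S)
    {A P : Matrix m m ℝ} (hA : A ∈ S) (hdet : A.det ≠ 0) (hP : P.PosDef) {a c : ℝ}
    (hac : a ≤ c * c) (hc : 0 < c) (h : (a • (A * P * Aᵀ) - P).PosDef) :
    (c • A, P) ∈ expandingPairs S := by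
  refine ⟨hsmul A hA c hc, hP, ?_⟩
  dsimp only
  rw [smul_mul_mul_smul_transpose]
  have := h.add_posSemidef ((hP.mul_mul_transpose hdet).posSemidef.smul (sub_nonneg.2 hac))
  convert this using 1
  rw [sub_smul]
  abel

theorem joinedIn_smul_expandingPairs (hsmul : ∀ A ∈ S, ∀ c : ℝ, 0 < c → c • A ∈ S)
    (hdet : ∀ A ∈ S, A.det ≠ 0) {q : Matrix m m ℝ × Matrix m m ℝ} (hq : q ∈ expandingPairs S)
    {c : ℝ} (hc : 1 ≤ c) : JoinedIn (expandingPairs S) q (c • q.1, q.2) := by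
  have hj : JoinedIn (Ici (1 : ℝ)) 1 c :=
    ((convex_Ici 1).isPathConnected ⟨1, self_mem_Ici⟩).joinedIn _ self_mem_Ici _ hc
  have := hj.map (f := fun a : ℝ => (a • q.1, q.2)) (by fun_prop)
  rw [one_smul] at this
  refine this.mono ?_
  rintro _ ⟨a, ha, rfl⟩
  rw [mem_Ici] at ha
  exact smul_mem_expandingPairs hsmul hq.1 (hdet _ hq.1) hq.2.1 (a := 1) (by nlinarith)
    (by linarith) (by simpa using hq.2.2)

theorem isPathConnected_expandingPairs (hS : IsPathConnected S)
    (hsmul : ∀ A ∈ S, ∀ c : ℝ, 0 < c → c • A ∈ S) (hdet : ∀ A ∈ S, A.det ≠ 0) :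
    IsPathConnected (expandingPairs S) := by
  rw [isPathConnected_iff]
  have hprod : IsPathConnected (S ×ˢ {P : Matrix m m ℝ | P.PosDef}) :=
    hS.prod (convex_setOf_posDef.isPathConnected ⟨1, PosDef.one⟩)
  have key : ∀ q ∈ S ×ˢ {P : Matrix m m ℝ | P.PosDef}, ∀ q' ∈ S ×ˢ {P : Matrix m m ℝ | P.PosDef},
      ∃ c : ℝ, 1 ≤ c ∧ JoinedIn (expandingPairs S) (c • q.1, q.2) (c • q'.1, q'.2) := by
    intro q hq q' hq'
    obtain ⟨γ, hγ⟩ := hprod.joinedIn q hq q' hq'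
    have h1 : Continuous fun t => (γ t).1 := continuous_fst.comp γ.continuous
    have h2 : Continuous fun t => (γ t).2 := continuous_snd.comp γ.continuous
    obtain ⟨c, hc, h⟩ := exists_forall_smul_sub_posDef
      (M := fun t => (γ t).1 * (γ t).2 * (γ t).1ᵀ) (P := fun t => (γ t).2) (by fun_prop) h2
      (fun t => (hγ t).2.mul_mul_transpose (hdet _ (hγ t).1)) fun t => (hγ t).2.isHermitian
    refine ⟨c, hc, γ.map (f := fun q => (c • q.1, q.2)) (by fun_prop), fun t => ?_⟩
    exact smul_mem_expandingPairs hsmul (hγ t).1 (hdet _ (hγ t).1) (hγ t).2 (by nlinarith)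
      (by linarith) (h t)
  refine ⟨?_, fun q hq q' hq' => ?_⟩
  · obtain ⟨q, hq⟩ := hprod.nonempty
    obtain ⟨c, -, h⟩ := key q hq q hq
    exact ⟨_, h.source_mem⟩
  · obtain ⟨c, hc, h⟩ := key q ⟨hq.1, hq.2.1⟩ q' ⟨hq'.1, hq'.2.1⟩
    exact (joinedIn_smul_expandingPairs hsmul hdet hq hc).trans
      (h.trans (joinedIn_smul_expandingPairs hsmul hdet hq' hc).symm)

end ExpandingPairs

end Matrix

namespace GoodPair

variable {n : ℕ} {p : Matrix (Fin n) (Fin n) ℝ × C(ℝ, Matrix (Fin n) (Fin n) ℝ)}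

theorem posDef_sub (hp : GoodPair n p) : (p.1 * p.2 0 * p.1ᵀ - p.2 0).PosDef := by
  have := hp.2.2.2 0 1 one_pos
  rwa [← zero_add (1 : ℝ), hp.2.2.1] at this

theorem det_ne_zero (hp : GoodPair n p) : p.1.det ≠ 0 := by
  intro h
  have h1 := (hp.2.1 (0 + 1)).det_pos
  rw [hp.2.2.1, det_mul, det_mul, h] at h1
  simp at h1

theorem mem_expandingPairs (hp : GoodPair n p) {S : Set (Matrix (Fin n) (Fin n) ℝ)}
    (hS : p.1 ∈ S) : (p.1, p.2 0) ∈ expandingPairs S :=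
  ⟨hS, hp.2.1 0, hp.posDef_sub⟩

/-- The paths with a given holonomy form a convex set. -/
theorem convex_fiber (A : Matrix (Fin n) (Fin n) ℝ) :
    Convex ℝ {f : C(ℝ, Matrix (Fin n) (Fin n) ℝ) | GoodPair n (A, f)} := by
  intro f hf g hg a b ha hb hab
  refine ⟨fun t => ?_, fun t => ?_, fun t => ?_, fun s t hst => ?_⟩
  · exact ((hf.1 t).smul a).add ((hg.1 t).smul b)
  · exact convex_setOf_posDef (hf.2.1 t) (hg.2.1 t) ha hb hab
  · have h1 := hf.2.2.1 t
    have h2 := hg.2.2.1 t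
    dsimp only at h1 h2
    simp [h1, h2, Matrix.mul_add, Matrix.add_mul]
  · have := convex_setOf_posDef (hf.2.2.2 s t hst) (hg.2.2.2 s t hst) ha hb hab
    rw [smul_sub, smul_sub, ← add_sub_add_comm] at this
    exact this

/-- The pair of a holonomy and an equivariant path built from an expanding pair. -/
noncomputable def ofExpandingPair {S : Set (Matrix (Fin n) (Fin n) ℝ)}
    (hdet : ∀ A ∈ S, A.det ≠ 0) (q : expandingPairs S) :
    Matrix (Fin n) (Fin n) ℝ × C(ℝ, Matrix (Fin n) (Fin n) ℝ) :=
  (q.1.1, ContinuousMap.curry ⟨_, continuous_equivariantInterpolation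
    (T := expandingPairs S) (A := fun q => q.1.1) (P := fun q => q.1.2)
    (by fun_prop) (by fun_prop) fun q => hdet _ q.2.1⟩ q)

theorem continuous_ofExpandingPair {S : Set (Matrix (Fin n) (Fin n) ℝ)}
    (hdet : ∀ A ∈ S, A.det ≠ 0) : Continuous (ofExpandingPair hdet) :=
  (by fun_prop : Continuous fun q : expandingPairs S => q.1.1).prodMk
    (ContinuousMap.continuous _)

theorem ofExpandingPair_snd_apply {S : Set (Matrix (Fin n) (Fin n) ℝ)}
    (hdet : ∀ A ∈ S, A.det ≠ 0) (q : expandingPairs S) (t : ℝ) :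
    (ofExpandingPair hdet q).2 t = equivariantInterpolation q.1.1 q.1.2 t :=
  rfl

theorem goodPair_ofExpandingPair {S : Set (Matrix (Fin n) (Fin n) ℝ)}
    (hdet : ∀ A ∈ S, A.det ≠ 0) (q : expandingPairs S) : GoodPair n (ofExpandingPair hdet q) := by
  have hA := hdet _ q.2.1
  have hpos := equivariantInterpolation_posDef hA q.2.2.1 q.2.2.2
  simp only [GoodPair, ofExpandingPair_snd_apply]
  exact ⟨fun t => by simpa using (hpos t).isHermitian, hpos,
    fun t => equivariantInterpolation_add_one hA _ t,
    fun s t hst => equivariantInterpolation_sub_posDef hA q.2.2.2 hst⟩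

/-- Over a path-connected cone of invertible holonomies, the good pairs form a path-connected
set. -/
theorem isPathConnected_setOf {S : Set (Matrix (Fin n) (Fin n) ℝ)} (hS : IsPathConnected S)
    (hsmul : ∀ A ∈ S, ∀ c : ℝ, 0 < c → c • A ∈ S) (hdet : ∀ A ∈ S, A.det ≠ 0) :
    IsPathConnected {p | GoodPair n p ∧ p.1 ∈ S} := by
  have hX := isPathConnected_expandingPairs hS hsmul hdet
  have : PathConnectedSpace (expandingPairs S) := isPathConnected_iff_pathConnectedSpace.1 hX
  have hrange : range (ofExpandingPair hdet) ⊆ {p | GoodPair n p ∧ p.1 ∈ S} := by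
    rintro _ ⟨q, rfl⟩
    exact ⟨goodPair_ofExpandingPair hdet q, q.2.1⟩
  have hpc := isPathConnected_range (continuous_ofExpandingPair hdet)
  have hfiber : ∀ p ∈ {p | GoodPair n p ∧ p.1 ∈ S}, ∃ q ∈ range (ofExpandingPair hdet),
      JoinedIn {p | GoodPair n p ∧ p.1 ∈ S} p q := by
    rintro ⟨A, f⟩ ⟨hp, hpS⟩
    set q : expandingPairs S := ⟨_, hp.mem_expandingPairs hpS⟩
    refine ⟨_, ⟨q, rfl⟩, ?_⟩
    have hj := ((convex_fiber A).isPathConnected ⟨f, hp⟩).joinedIn f hp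
      (ofExpandingPair hdet q).2 (goodPair_ofExpandingPair hdet q)
    refine (hj.map (f := fun g => (A, g)) (by fun_prop)).mono ?_
    rintro _ ⟨g, hg, rfl⟩
    exact ⟨hg, hpS⟩
  rw [isPathConnected_iff]
  refine ⟨hpc.nonempty.mono hrange, fun p hp p' hp' => ?_⟩
  obtain ⟨q, hq, h⟩ := hfiber p hp
  obtain ⟨q', hq', h'⟩ := hfiber p' hp'
  exact h.trans (((hpc.joinedIn q hq q' hq').mono hrange).trans h'.symm)

end GoodPair

/-- Every pair in `𝒮` has holonomy of nonzero determinant; the subsets `𝒮⁺` and `𝒮⁻`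
where the determinant of the holonomy is positive, resp. negative, are nonempty and each
is path-connected: `𝒮` has exactly two connected components, distinguished by the sign of
the determinant of the holonomy. -/
theorem components_of_equivariant_positive_paths (n : ℕ) (hn : 1 ≤ n) :
    (∀ p : Matrix (Fin n) (Fin n) ℝ × C(ℝ, Matrix (Fin n) (Fin n) ℝ),
        GoodPair n p → p.1.det ≠ 0) ∧
    {p : Matrix (Fin n) (Fin n) ℝ × C(ℝ, Matrix (Fin n) (Fin n) ℝ) |
      GoodPair n p ∧ 0 < p.1.det}.Nonempty ∧
    {p : Matrix (Fin n) (Fin n) ℝ × C(ℝ, Matrix (Fin n) (Fin n) ℝ) |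
      GoodPair n p ∧ p.1.det < 0}.Nonempty ∧
    IsPathConnected {p : Matrix (Fin n) (Fin n) ℝ × C(ℝ, Matrix (Fin n) (Fin n) ℝ) |
      GoodPair n p ∧ 0 < p.1.det} ∧
    IsPathConnected {p : Matrix (Fin n) (Fin n) ℝ × C(ℝ, Matrix (Fin n) (Fin n) ℝ) |
      GoodPair n p ∧ p.1.det < 0} := by
  have : Nonempty (Fin n) := ⟨⟨0, hn⟩⟩
  have hpos : IsPathConnected {p : Matrix (Fin n) (Fin n) ℝ × C(ℝ, Matrix (Fin n) (Fin n) ℝ) |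
      GoodPair n p ∧ 0 < p.1.det} :=
    GoodPair.isPathConnected_setOf isPathConnected_setOf_det_pos
      (fun A hA c hc => by
        simpa only [mem_ofPred_eq, det_smul] using mul_pos (pow_pos hc _) hA)
      fun A hA => ne_of_gt hA
  have hneg : IsPathConnected {p : Matrix (Fin n) (Fin n) ℝ × C(ℝ, Matrix (Fin n) (Fin n) ℝ) |
      GoodPair n p ∧ p.1.det < 0} :=
    GoodPair.isPathConnected_setOf isPathConnected_setOf_det_neg
      (fun A hA c hc => by
        simpa only [mem_ofPred_eq, det_smul] using mul_neg_of_pos_of_neg (pow_pos hc _) hA)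
      fun A hA => ne_of_lt hA
  exact ⟨fun p hp => hp.det_ne_zero, hpos.nonempty, hneg.nonempty, hpos, hneg⟩
end

section
/- Fix n ≥ 1. The subset of Sp(2n,ℝ) consisting of those matrices M = fromBlocks A B C D (n×n blocks) in the symplectic group with C = 0 and det A > 0 is path-connected. (This is the stabilizer in Sp(2n,ℝ) of an oriented Lagrangian; its connectedness is the key step showing that the fibers of the enhanced representation space over the quotient representation space are connected.) -/
open Matrix

namespace Matrix

variable {ι : Type*} [Fintype ι] [DecidableEq ι]

theorem joinedIn_det_ne_zero_mul {A A' B B' : Matrix ι ι ℝ}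
    (hA : JoinedIn {M : Matrix ι ι ℝ | M.det ≠ 0} A A')
    (hB : JoinedIn {M : Matrix ι ι ℝ | M.det ≠ 0} B B') :
    JoinedIn {M : Matrix ι ι ℝ | M.det ≠ 0} (A * B) (A' * B') := by
  refine (hA.mul hB).mono ?_
  rintro _ ⟨M, hM, N, hN, rfl⟩
  simpa [det_mul] using ⟨hM, hN⟩

theorem joinedIn_det_ne_zero_transvection {i j : ι} (hij : i ≠ j) (c : ℝ) :
    JoinedIn {M : Matrix ι ι ℝ | M.det ≠ 0} (transvection i j c) 1 := by
  have h : JoinedIn (Set.univ : Set ℝ) c 0 :=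
    isPathConnected_univ.joinedIn _ (Set.mem_univ _) _ (Set.mem_univ _)
  have hf : Continuous fun c : ℝ => transvection i j c := by
    unfold transvection
    refine continuous_const.add (continuous_matrix fun a b => ?_)
    simp only [single_apply]
    split_ifs <;> fun_prop
  have := h.map hf
  simp only [transvection_zero] at this
  refine this.mono ?_
  rintro _ ⟨x, -, rfl⟩
  simp [det_transvection_of_ne i j hij]

theorem joinedIn_det_ne_zero_diagonal_mulSingle (i : ι) {s : Set ℝ} (hs : (0 : ℝ) ∉ s)
    {a b : ℝ} (h : JoinedIn s a b) :
    JoinedIn {M : Matrix ι ι ℝ | M.det ≠ 0}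
      (diagonal (Pi.mulSingle i a)) (diagonal (Pi.mulSingle i b)) := by
  have hf : Continuous fun c : ℝ => (diagonal (Pi.mulSingle i c) : Matrix ι ι ℝ) :=
    (continuous_mulSingle i).matrix_diagonal
  refine (h.map hf).mono ?_
  rintro _ ⟨x, hx, rfl⟩
  have hx0 : x ≠ 0 := fun h0 => hs (h0 ▸ hx)
  simpa [det_diagonal, Finset.prod_pi_mulSingle'] using hx0

/-- Two coordinate reflections are joined through reflections along a segment of vectors. -/
theorem joinedIn_det_ne_zero_reflection (i j : ι) :
    JoinedIn {M : Matrix ι ι ℝ | M.det ≠ 0}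
      (diagonal (Pi.mulSingle i (-1))) (diagonal (Pi.mulSingle j (-1))) := by
  rcases eq_or_ne i j with rfl | hij
  · refine JoinedIn.refl ?_
    simp [det_diagonal, Finset.prod_pi_mulSingle']
  let v : ℝ → ι → ℝ := fun t => (1 - t) • Pi.single i 1 + t • Pi.single j 1
  have hdot : ∀ t, v t ⬝ᵥ v t = (1 - t) ^ 2 + t ^ 2 := fun t => by
    simp [v, hij, hij.symm]
    ring
  have hpos : ∀ t, v t ⬝ᵥ v t ≠ 0 := fun t => by
    rw [hdot]
    nlinarith [sq_nonneg (1 - 2 * t)]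
  have hv : Continuous v := by fun_prop
  let f : ℝ → Matrix ι ι ℝ := fun t => 1 - (2 / (v t ⬝ᵥ v t)) • vecMulVec (v t) (v t)
  have hf : Continuous f := by
    refine continuous_const.sub (Continuous.fun_smul ?_ (hv.matrix_vecMulVec hv))
    exact continuous_const.div (hv.dotProduct hv) hpos
  have hsq : ∀ t, f t * f t = 1 := fun t => by
    have h := hpos t
    simp only [f, sub_mul, mul_sub, smul_mul_assoc, mul_smul_comm, vecMulVec_mul_vecMulVec,
      one_mul, mul_one, vecMulVec_smul, smul_sub, smul_smul]
    rw [show 2 / (v t ⬝ᵥ v t) * (2 / (v t ⬝ᵥ v t) * (v t ⬝ᵥ v t)) =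
      2 / (v t ⬝ᵥ v t) + 2 / (v t ⬝ᵥ v t) by field_simp; norm_num, add_smul]
    abel
  have hcoord : ∀ k : ι, (1 : Matrix ι ι ℝ) - (2 : ℝ) •
      vecMulVec (Pi.single k 1) (Pi.single k 1) = diagonal (Pi.mulSingle k (-1)) := fun k => by
    ext a b
    by_cases hab : a = b <;> by_cases hak : a = k <;>
      simp_all [vecMulVec_apply, Pi.single_apply]
    norm_num
  have h : JoinedIn (Set.univ : Set ℝ) 0 1 :=
    isPathConnected_univ.joinedIn _ (Set.mem_univ _) _ (Set.mem_univ _)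
  have h0 : f 0 = diagonal (Pi.mulSingle i (-1)) := by simp [f, v, ← hcoord]
  have h1 : f 1 = diagonal (Pi.mulSingle j (-1)) := by simp [f, v, ← hcoord]
  rw [← h0, ← h1]
  refine (h.map hf).mono ?_
  rintro _ ⟨t, -, rfl⟩
  have := congrArg det (hsq t)
  rw [det_mul, det_one] at this
  exact left_ne_zero_of_mul_eq_one this

theorem joinedIn_det_ne_zero_one_or_reflection (k : ι) (A : Matrix ι ι ℝ) (hA : A.det ≠ 0) :
    JoinedIn {M : Matrix ι ι ℝ | M.det ≠ 0} A 1 ∨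
      JoinedIn {M : Matrix ι ι ℝ | M.det ≠ 0} A (diagonal (Pi.mulSingle k (-1))) := by
  let P : Matrix ι ι ℝ → Prop := fun A =>
    JoinedIn {M : Matrix ι ι ℝ | M.det ≠ 0} A 1 ∨
      JoinedIn {M : Matrix ι ι ℝ | M.det ≠ 0} A (diagonal (Pi.mulSingle k (-1)))
  have hmul : ∀ A B, P A → P B → P (A * B) := by
    rintro A B (hA | hA) (hB | hB)
    · exact Or.inl (by simpa using joinedIn_det_ne_zero_mul hA hB)
    · exact Or.inr (by simpa using joinedIn_det_ne_zero_mul hA hB)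
    · exact Or.inr (by simpa using joinedIn_det_ne_zero_mul hA hB)
    · refine Or.inl ?_
      have := joinedIn_det_ne_zero_mul hA hB
      rw [diagonal_mul_diagonal, ← Pi.mul_def, ← Pi.mulSingle_mul] at this
      simpa using this
  refine diagonal_transvection_induction_of_det_ne_zero P A hA (fun D hD => ?_)
    (fun t => Or.inl (joinedIn_det_ne_zero_transvection t.hij t.c))
    (fun A B _ _ => hmul A B)
  rw [det_diagonal, Finset.prod_ne_zero_iff] at hD
  rw [← Finset.univ_prod_mulSingle D]
  refine Finset.prod_induction _ (fun d => P (diagonal d)) (fun a b ha hb => ?_) ?_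
    (fun i hi => ?_)
  · have := hmul _ _ ha hb
    rwa [diagonal_mul_diagonal] at this
  · exact Or.inl (by simpa using JoinedIn.refl (by simp))
  · rcases (hD i hi).lt_or_gt with h | h
    · refine Or.inr (JoinedIn.trans ?_ (joinedIn_det_ne_zero_reflection i k))
      exact joinedIn_det_ne_zero_diagonal_mulSingle i (s := Set.Iio 0) (by simp)
        ((convex_Iio 0).isPathConnected ⟨_, h⟩ |>.joinedIn _ h _ (by simp))
    · refine Or.inl ?_
      have := joinedIn_det_ne_zero_diagonal_mulSingle i (s := Set.Ioi 0) (by simp)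
        ((convex_Ioi 0).isPathConnected ⟨_, h⟩ |>.joinedIn _ h 1 (by simp))
      simpa using this

theorem joinedIn_det_pos {A B : Matrix ι ι ℝ}
    (h : JoinedIn {M : Matrix ι ι ℝ | M.det ≠ 0} A B) (hA : 0 < A.det) :
    JoinedIn {M : Matrix ι ι ℝ | 0 < M.det} A B := by
  obtain ⟨γ, hγ⟩ := h
  refine ⟨γ, fun t => ?_⟩
  by_contra ht
  have hc : Continuous fun s => (γ s).det := γ.continuous.matrix_det
  obtain ⟨s, hs⟩ := mem_range_of_exists_le_of_exists_ge hc ⟨t, not_lt.mp ht⟩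
    ⟨0, by simpa using hA.le⟩
  exact hγ s hs

theorem isPathConnected_det_pos [Nonempty ι] :
    IsPathConnected {M : Matrix ι ι ℝ | 0 < M.det} := by
  refine ⟨1, by simp, fun {A} hA => ?_⟩
  obtain ⟨k⟩ := ‹Nonempty ι›
  rcases joinedIn_det_ne_zero_one_or_reflection k A (ne_of_gt hA) with h | h
  · exact (joinedIn_det_pos h hA).symm
  · have := (joinedIn_det_pos h hA).target_mem
    simp only [Set.mem_ofPred_eq, det_diagonal, Finset.prod_pi_mulSingle', Finset.mem_univ,
      if_true] at this
    norm_num at this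

theorem isPathConnected_isSymm {m : Type*} : IsPathConnected {S : Matrix m m ℝ | S.IsSymm} := by
  refine Convex.isPathConnected (fun A hA B hB a b _ _ _ => ?_) ⟨0, isSymm_zero⟩
  exact (IsSymm.smul hA a).add (IsSymm.smul hB b)

theorem continuousOn_inv_det_ne_zero :
    ContinuousOn (fun A : Matrix ι ι ℝ => A⁻¹) {A | A.det ≠ 0} := by
  simp only [inv_def, Ring.inverse_eq_inv']
  exact ContinuousOn.smul (continuous_id.matrix_det.continuousOn.inv₀ fun _ h => h)
    continuous_id.matrix_adjugate.continuousOn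

theorem fromBlocks_zero₂₁_mem_symplecticGroup_iff {R : Type*} [CommRing R]
    {A B D : Matrix ι ι R} :
    fromBlocks A B 0 D ∈ symplecticGroup ι R ↔ A * Dᵀ = 1 ∧ (B * Aᵀ).IsSymm := by
  rw [SymplecticGroup.mem_iff, J, fromBlocks_transpose, fromBlocks_multiply, fromBlocks_multiply,
    fromBlocks_inj]
  simp only [Matrix.mul_zero, Matrix.mul_one, Matrix.mul_neg, Matrix.neg_mul, zero_add, add_zero,
    transpose_zero, Matrix.zero_mul, neg_zero, neg_inj, IsSymm, transpose_mul,
    transpose_transpose, and_true]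
  constructor
  · rintro ⟨h1, h2, -⟩
    exact ⟨h2, (add_neg_eq_zero.mp h1).symm⟩
  · rintro ⟨h1, h2⟩
    refine ⟨add_neg_eq_zero.mpr h2.symm, h1, ?_⟩
    have := congrArg transpose h1
    simpa using this

theorem setOf_symplectic_stabilizer_eq_image :
    {M : Matrix (ι ⊕ ι) (ι ⊕ ι) ℝ |
      M ∈ symplecticGroup ι ℝ ∧ M.toBlocks₂₁ = 0 ∧ 0 < M.toBlocks₁₁.det} =
    (fun p : Matrix ι ι ℝ × Matrix ι ι ℝ => fromBlocks p.1 (p.2 * p.1⁻¹ᵀ) 0 p.1⁻¹ᵀ) ''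
      ({A | 0 < A.det} ×ˢ {S | S.IsSymm}) := by
  ext M
  constructor
  · rintro ⟨hM, hC, hA⟩
    rw [← fromBlocks_toBlocks M, hC, fromBlocks_zero₂₁_mem_symplecticGroup_iff] at hM
    refine ⟨(M.toBlocks₁₁, M.toBlocks₁₂ * M.toBlocks₁₁ᵀ), ⟨hA, hM.2⟩, ?_⟩
    have hinv : M.toBlocks₁₁⁻¹ = M.toBlocks₂₂ᵀ := inv_eq_right_inv hM.1
    have hAD : M.toBlocks₁₁ᵀ * M.toBlocks₂₂ = 1 := by
      have := congrArg transpose (mul_eq_one_comm.mp hM.1)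
      simpa using this
    conv_rhs => rw [← fromBlocks_toBlocks M, hC]
    simp only [hinv, transpose_transpose, Matrix.mul_assoc, hAD, Matrix.mul_one]
  · rintro ⟨⟨A, S⟩, ⟨hA, hS⟩, rfl⟩
    have hu : IsUnit A.det := (ne_of_gt hA).isUnit
    refine ⟨fromBlocks_zero₂₁_mem_symplecticGroup_iff.mpr ⟨?_, ?_⟩, ?_, ?_⟩
    · simp [mul_nonsing_inv _ hu]
    · rw [Matrix.mul_assoc, ← transpose_mul, mul_nonsing_inv _ hu, transpose_one, Matrix.mul_one]
      exact hS
    · simp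
    · simpa using hA

end Matrix

/-- The stabilizer in `Sp(2n,ℝ)` of an oriented Lagrangian — the set of symplectic block
matrices `fromBlocks A B C D` with `C = 0` and `det A > 0` — is path-connected. -/
theorem stabilizer_oriented_lagrangian_pathConnected (n : ℕ) (hn : 1 ≤ n) :
    IsPathConnected {M : Matrix (Fin n ⊕ Fin n) (Fin n ⊕ Fin n) ℝ |
      M ∈ Matrix.symplecticGroup (Fin n) ℝ ∧ M.toBlocks₂₁ = 0 ∧ 0 < M.toBlocks₁₁.det} := by
  have : Nonempty (Fin n) := ⟨⟨0, hn⟩⟩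
  rw [setOf_symplectic_stabilizer_eq_image]
  refine (isPathConnected_det_pos.prod isPathConnected_isSymm).image' ?_
  have hinv : ContinuousOn (fun p : Matrix (Fin n) (Fin n) ℝ × Matrix (Fin n) (Fin n) ℝ => p.1⁻¹ᵀ)
      ({A | 0 < A.det} ×ˢ {S | S.IsSymm}) :=
    (continuous_id.matrix_transpose).comp_continuousOn
      (continuousOn_inv_det_ne_zero.comp continuousOn_fst fun p hp => ne_of_gt hp.1)
  rw [continuousOn_iff_continuous_domRestrict] at hinv ⊢
  refine Continuous.matrix_fromBlocks (by fun_prop) ?_ continuous_const hinv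
  exact (continuous_snd.comp continuous_subtype_val).matrix_mul hinv
end
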